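/- arXiv:2009.02991 — 10 statements merged into one kernel-verified Lean document; each statement's English description precedes it below -/
import Mathlib

section
/- Let F be a field, Q ⊆ F^n a linear code, x ∈ F^n and T ⊆ {1,…,n}. Then there exists y ∈ Q with x_i = y_i for all i ∈ T if and only if ∑_{i=1}^n x_i v_i = 0 for every v ∈ Q^⊥ with supp(v) ⊆ T. -/
/-- The dual code of a set of vectors `Q ⊆ F^ι`. -/
def dualCode {F : Type*} [Field F] {ι : Type*} [Fintype ι] (Q : Set (ι → F)) :
    Set (ι → F) :=
  {v | ∀ x ∈ Q, ∑ i, v i * x i = 0}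

/-- The support of a vector. -/
def supp {F : Type*} [Zero F] {ι : Type*} (v : ι → F) : Set ι := {i | v i ≠ 0}

/-- The lift of a code `Q` over a collection `𝒯` of subsets of the coordinate set. -/
def lift {F : Type*} {ι : Type*} (Q : Set (ι → F)) (𝒯 : Set (Set ι)) :
    Set (ι → F) :=
  {x | ∀ T ∈ 𝒯, ∃ y ∈ Q, ∀ i ∈ T, x i = y i}

/-- A collusion pattern: a collection of subsets closed under taking subsets. -/
def IsCollusionPattern {ι : Type*} (𝒯 : Set (Set ι)) : Prop :=
  ∀ T ∈ 𝒯, ∀ T' ⊆ T, T' ∈ 𝒯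

/-- A circuit of a code `Q`: the support of a nonzero dual vector that is
minimal among supports of nonzero dual vectors. -/
def IsCircuit {F : Type*} [Field F] {ι : Type*} [Fintype ι] (Q : Set (ι → F))
    (C : Set ι) : Prop :=
  (∃ v ∈ dualCode Q, v ≠ 0 ∧ supp v = C) ∧
    ∀ w ∈ dualCode Q, w ≠ 0 → ¬ supp w ⊂ C

theorem statement0 {F : Type*} [Field F] {n : ℕ} (Q : Submodule F (Fin n → F))
    (x : Fin n → F) (T : Set (Fin n)) :
    (∃ y ∈ Q, ∀ i ∈ T, x i = y i) ↔
      ∀ v ∈ dualCode (Q : Set (Fin n → F)), supp v ⊆ T → ∑ i, x i * v i = 0 := by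
  constructor
  · rintro ⟨y, hy, hxy⟩ v hv hT
    rw [← hv y hy]
    refine Finset.sum_congr rfl fun i _ => ?_
    by_cases hi : v i = 0
    · simp [hi]
    · rw [hxy i (hT hi), mul_comm]
  · intro h
    let K : Submodule F (Fin n → F) := Submodule.pi T fun _ => ⊥
    have hx : x ∈ Q ⊔ K := by
      by_contra hx
      obtain ⟨f, hfx, hf⟩ := Submodule.exists_le_ker_of_notMem hx
      have hsum (z : Fin n → F) : ∑ i, z i * f (Pi.single i 1) = f z := by
        conv_rhs => rw [pi_eq_sum_univ' z]
        simp only [map_sum, map_smul, smul_eq_mul]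
      refine hfx ((hsum x).symm.trans (h (fun i => f (Pi.single i 1)) (fun z hz => ?_) ?_))
      · simp_rw [mul_comm _ (z _)]
        rw [hsum]
        exact hf (Submodule.mem_sup_left hz)
      · intro i hi
        by_contra hiT
        refine hi (hf (Submodule.mem_sup_right (Submodule.mem_pi.2 fun j hj => ?_)))
        have hji : j ≠ i := fun e => hiT (e ▸ hj)
        simp [hji]
    obtain ⟨y, hy, z, hz, rfl⟩ := Submodule.mem_sup.1 hx
    refine ⟨y, hy, fun i hi => ?_⟩
    have hzi : z i = 0 := Submodule.mem_pi.1 hz i hi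
    simp [hzi]
end

section
/- Let F be a field, Q ⊆ F^n a linear code and 𝒯 a collusion pattern on {1,…,n}. Then Q^𝒯 = {x ∈ F^n : ∑_{i=1}^n x_i v_i = 0 for every v ∈ Q^⊥ whose support is contained in some T ∈ 𝒯}. -/
/-- A vector orthogonal to all dual vectors supported in `T` agrees on `T` with a codeword. -/
theorem exists_mem_eqOn_of_forall_dualCode {F ι : Type*} [Field F] [Fintype ι]
    (Q : Submodule F (ι → F)) (T : Set ι) {x : ι → F}
    (hx : ∀ v ∈ dualCode (Q : Set (ι → F)), supp v ⊆ T → ∑ i, x i * v i = 0) :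
    ∃ y ∈ Q, ∀ i ∈ T, x i = y i := by
  classical
  let Z : Submodule F (ι → F) := Submodule.pi T fun _ => (⊥ : Submodule F F)
  have hxW : x ∈ Q ⊔ Z := by
    by_contra h
    obtain ⟨f, hfx, hf⟩ := Submodule.exists_le_ker_of_notMem h
    have hsum (z : ι → F) : f z = ∑ i, z i * f (Pi.single i 1) := by
      conv_lhs => rw [← Finset.univ_sum_single z, map_sum]
      refine Finset.sum_congr rfl fun i _ => ?_
      rw [← smul_eq_mul, ← map_smul, ← Pi.single_smul, smul_eq_mul, mul_one]
    refine hfx ?_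
    rw [hsum]
    refine hx (fun i => f (Pi.single i 1)) (fun y hy => ?_) (fun i hi => ?_)
    · have hfy : f y = 0 := hf (Submodule.mem_sup_left hy)
      rw [hsum] at hfy
      simpa only [mul_comm] using hfy
    · by_contra hiT
      refine hi (hf (Submodule.mem_sup_right ?_))
      refine Submodule.mem_pi.2 fun j hj => ?_
      have hji : j ≠ i := fun h => hiT (h ▸ hj)
      exact (Submodule.mem_bot F).2 (Pi.single_eq_of_ne hji 1)
  obtain ⟨y, hy, z, hz, rfl⟩ := Submodule.mem_sup.1 hxW
  refine ⟨y, hy, fun i hi => ?_⟩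
  have hzi : z i = 0 := hz i hi
  simp [hzi]

theorem statement1 {F : Type*} [Field F] {n : ℕ} (Q : Submodule F (Fin n → F))
    (𝒯 : Set (Set (Fin n))) (h𝒯 : IsCollusionPattern 𝒯) :
    lift (Q : Set (Fin n → F)) 𝒯 =
      {x | ∀ v ∈ dualCode (Q : Set (Fin n → F)),
        (∃ T ∈ 𝒯, supp v ⊆ T) → ∑ i, x i * v i = 0} := by
  ext x
  constructor
  · rintro hx v hv ⟨T, hT, hvT⟩
    obtain ⟨y, hy, hxy⟩ := hx T hT
    rw [← hv y hy]
    refine Finset.sum_congr rfl fun i _ => ?_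
    by_cases hi : v i = 0
    · simp [hi]
    · rw [hxy i (hvT hi), mul_comm]
  · intro hx T hT
    exact exists_mem_eqOn_of_forall_dualCode Q T fun v hv hvT => hx v hv ⟨T, hT, hvT⟩
end

section
/- Let F be a field, Q ⊆ F^n a linear code with set of circuits 𝒞, and 𝒯 a collusion pattern on {1,…,n}. Then Q^𝒯 equals the lift of Q over the collection 𝒯 ∩ 𝒞 = {C ∈ 𝒞 : C ∈ 𝒯}. -/
/-- A vector orthogonal to every dual vector supported in `T` agrees on `T` with a codeword. -/
theorem exists_mem_eq_on_of_orthogonal {F ι : Type*} [Field F] [Fintype ι]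
    (Q : Submodule F (ι → F)) (T : Set ι) (x : ι → F)
    (h : ∀ v ∈ dualCode (Q : Set (ι → F)), supp v ⊆ T → ∑ i, v i * x i = 0) :
    ∃ y ∈ Q, ∀ i ∈ T, x i = y i := by
  classical
  let P : (ι → F) →ₗ[F] (T → F) := LinearMap.funLeft F F Subtype.val
  by_cases hx : P x ∈ Q.map P
  · obtain ⟨y, hy, hyx⟩ := hx
    exact ⟨y, hy, fun i hi => (congrFun hyx ⟨i, hi⟩).symm⟩
  · obtain ⟨f, hfx, hfQ⟩ := Submodule.exists_le_ker_of_notMem hx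
    have key (z : ι → F) : ∑ i, f (P (Pi.single i 1)) * z i = f (P z) := by
      rw [← LinearMap.comp_apply, LinearMap.pi_apply_eq_sum_univ (f ∘ₗ P) z]
      refine Finset.sum_congr rfl fun i _ => ?_
      have hsingle : (fun j => if i = j then (1 : F) else 0) = Pi.single i 1 := by
        ext j
        simp [Pi.single_apply, eq_comm]
      rw [smul_eq_mul, mul_comm, hsingle, LinearMap.comp_apply]
    refine absurd ?_ hfx
    rw [← key x]
    refine h _ (fun z hz => ?_) fun i hi => ?_
    · rw [key z]
      exact hfQ (Submodule.mem_map_of_mem hz)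
    · by_contra hiT
      refine hi ?_
      have : P (Pi.single i 1) = 0 := by
        ext ⟨j, hj⟩
        have hji : j ≠ i := fun e => hiT (e ▸ hj)
        simp [P, LinearMap.funLeft_apply, hji]
      simp [this]

/-- A vector that agrees with a codeword on each circuit inside `T` is orthogonal to every dual
vector supported in `T`. -/
theorem orthogonal_of_eq_on_circuits {F ι : Type*} [Field F] [Fintype ι]
    (Q : Set (ι → F)) (T : Set ι) (x : ι → F)
    (h : ∀ C ⊆ T, IsCircuit Q C → ∃ y ∈ Q, ∀ i ∈ C, x i = y i)
    (v : ι → F) (hv : v ∈ dualCode Q) (hvT : supp v ⊆ T) : ∑ i, v i * x i = 0 := by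
  induction hn : (supp v).ncard using Nat.strong_induction_on generalizing v with
  | _ n ih =>
  subst hn
  by_cases hv0 : v = 0
  · simp [hv0]
  by_cases hC : IsCircuit Q (supp v)
  · obtain ⟨y, hy, hxy⟩ := h _ hvT hC
    rw [← hv y hy]
    refine Finset.sum_congr rfl fun i _ => ?_
    by_cases hi : v i = 0
    · simp [hi]
    · rw [hxy i hi]
  · obtain ⟨w, hw, hw0, hwv⟩ : ∃ w ∈ dualCode Q, w ≠ 0 ∧ supp w ⊂ supp v := by
      by_contra! hmin
      exact hC ⟨⟨v, hv, hv0, rfl⟩, hmin⟩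
    obtain ⟨i, hi⟩ := Function.ne_iff.mp hw0
    have hi' : w i ≠ 0 := hi
    have hsum (z : ι → F) : ∑ j, (v - (v i / w i) • w) j * z j =
        ∑ j, v j * z j - v i / w i * ∑ j, w j * z j := by
      simp [sub_mul, Finset.sum_sub_distrib, Finset.mul_sum, mul_assoc]
    have hsub : supp (v - (v i / w i) • w) ⊂ supp v := by
      refine ⟨fun j hj hvj => hj ?_, fun hle => ?_⟩
      · have hwj : w j = 0 := by
          by_contra hwj
          exact hwv.subset hwj hvj
        simp [hvj, hwj]
      · exact hle (hwv.subset hi') (by simp [hi'])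
    have hw_sum := ih _ (Set.ncard_lt_ncard hwv) w hw (hwv.subset.trans hvT) rfl
    have hsub_sum := ih _ (Set.ncard_lt_ncard hsub) (v - (v i / w i) • w)
      (fun z hz => by rw [hsum, hv z hz, hw z hz]; simp) (hsub.subset.trans hvT) rfl
    rwa [hsum, hw_sum, mul_zero, sub_zero] at hsub_sum

theorem statement5 {F : Type*} [Field F] {n : ℕ} (Q : Submodule F (Fin n → F))
    (𝒯 : Set (Set (Fin n))) (h𝒯 : IsCollusionPattern 𝒯) :
    lift (Q : Set (Fin n → F)) 𝒯 =
      lift (Q : Set (Fin n → F))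
        {C | C ∈ 𝒯 ∧ IsCircuit (Q : Set (Fin n → F)) C} := by
  refine Set.Subset.antisymm (fun x hx C hC => hx C hC.1) fun x hx T hT => ?_
  refine exists_mem_eq_on_of_orthogonal Q T x (orthogonal_of_eq_on_circuits _ T x ?_)
  exact fun C hCT hC => hx C ⟨h𝒯 T hT C hCT, hC⟩
end

section
/- Let F be a field, Q ⊆ F^n a linear code and 𝒯 a collusion pattern on {1,…,n}. If every circuit of Q belongs to 𝒯, then Q^𝒯 = Q. -/
/-- A vector of the lift over a collection containing every circuit is annihilated by the
dual code. -/
theorem sum_mul_eq_zero_of_mem_lift {F ι : Type*} [Field F] [Fintype ι] {Q : Set (ι → F)}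
    {𝒯 : Set (Set ι)} (h : ∀ C, IsCircuit Q C → C ∈ 𝒯) {x : ι → F} (hx : x ∈ lift Q 𝒯)
    {v : ι → F} (hv : v ∈ dualCode Q) : ∑ i, v i * x i = 0 := by
  by_contra hvx
  obtain ⟨u, ⟨hu, hux⟩, hmin⟩ := exists_minimalFor_of_wellFoundedLT
    (fun u : ι → F => u ∈ dualCode Q ∧ ∑ i, u i * x i ≠ 0) supp ⟨v, hv, hvx⟩
  have hu0 : u ≠ 0 := by
    rintro rfl
    simp at hux
  by_cases hc : IsCircuit Q (supp u)
  · obtain ⟨y, hy, hxy⟩ := hx _ (h _ hc)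
    refine hux ((Finset.sum_congr rfl fun i _ => ?_).trans (hu y hy))
    by_cases hi : u i = 0
    · simp [hi]
    · rw [hxy i hi]
  · obtain ⟨w, hw, hw0, hwu⟩ : ∃ w ∈ dualCode Q, w ≠ 0 ∧ supp w ⊂ supp u := by
      by_contra! hno
      exact hc ⟨⟨u, hu, hu0, rfl⟩, hno⟩
    have hwx : ∑ i, w i * x i = 0 := by
      by_contra hne
      exact hwu.2 (hmin ⟨hw, hne⟩ hwu.1)
    obtain ⟨j, hj⟩ := Function.ne_iff.mp hw0
    have hsum (z : ι → F) : ∑ i, (u - (u j / w j) • w) i * z i =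
        ∑ i, u i * z i - u j / w j * ∑ i, w i * z i := by
      simp [sub_mul, Finset.mul_sum, mul_assoc]
    have hle : supp (u - (u j / w j) • w) ⊆ supp u := by
      intro i hi hui
      have hwi : w i = 0 := by
        by_contra hne
        exact hwu.1 hne hui
      exact hi (by simp [hui, hwi])
    have hge := hmin (j := u - (u j / w j) • w)
      ⟨fun z hz => by rw [hsum, hu z hz, hw z hz, mul_zero, sub_zero],
        by rwa [hsum, hwx, mul_zero, sub_zero]⟩ hle
    exact hge (hwu.1 hj) (by simp [div_mul_cancel₀ _ hj])

/-- A vector annihilated by the dual code of a linear code belongs to that code. -/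
theorem mem_of_forall_dualCode {F ι : Type*} [Field F] [Fintype ι] (Q : Submodule F (ι → F))
    {x : ι → F} (hx : ∀ v ∈ dualCode (Q : Set (ι → F)), ∑ i, v i * x i = 0) : x ∈ Q := by
  classical
  by_contra hxQ
  obtain ⟨f, hfx, hQ⟩ := Submodule.exists_le_ker_of_notMem hxQ
  have hf (z : ι → F) : ∑ i, (dotProductEquiv F ι).symm f i * z i = f z :=
    LinearMap.congr_fun ((dotProductEquiv F ι).apply_symm_apply f) z
  exact hfx (hf x ▸ hx _ fun z hz => (hf z).trans (hQ hz))

theorem statement6 {F : Type*} [Field F] {n : ℕ} (Q : Submodule F (Fin n → F))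
    (𝒯 : Set (Set (Fin n))) (h𝒯 : IsCollusionPattern 𝒯)
    (h : ∀ C : Set (Fin n), IsCircuit (Q : Set (Fin n → F)) C → C ∈ 𝒯) :
    lift (Q : Set (Fin n → F)) 𝒯 = (Q : Set (Fin n → F)) := by
  refine Set.Subset.antisymm (fun x hx => ?_) fun x hx T _ => ⟨x, hx, fun _ _ => rfl⟩
  exact mem_of_forall_dualCode Q fun v hv => sum_mul_eq_zero_of_mem_lift h hx hv
end

section
/- Let F be a field, Q ⊆ F^n a linear code and 𝒯 a collusion pattern on {1,…,n}. Then Q^𝒯 = F^n if and only if no circuit of Q belongs to 𝒯. -/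
/-- The support of a nonzero dual vector contains a circuit. -/
theorem exists_isCircuit_subset_supp {F : Type*} [Field F] {ι : Type*} [Fintype ι]
    {Q : Set (ι → F)} {v : ι → F} (hv : v ∈ dualCode Q) (hv0 : v ≠ 0) :
    ∃ C, IsCircuit Q C ∧ C ⊆ supp v := by
  obtain ⟨C, hC, hmin⟩ :=
    (Set.toFinite {C | ∃ w ∈ dualCode Q, w ≠ 0 ∧ supp w = C}).exists_le_minimal
      (a := supp v) ⟨v, hv, hv0, rfl⟩
  exact ⟨C, ⟨hmin.prop, fun w hw hw0 hlt => hmin.not_lt ⟨w, hw, hw0, rfl⟩ hlt⟩, hC⟩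

/-- If a vector agrees on `T` with no codeword of `Q`, then `Q` has a nonzero dual vector
supported in `T`. -/
theorem exists_mem_dualCode_supp_subset {F : Type*} [Field F] {ι : Type*} [Fintype ι]
    (Q : Submodule F (ι → F)) {T : Set ι} {x : ι → F}
    (hx : ¬ ∃ y ∈ Q, ∀ i ∈ T, x i = y i) :
    ∃ v ∈ dualCode (Q : Set (ι → F)), v ≠ 0 ∧ supp v ⊆ T := by
  classical
  let K : Submodule F (ι → F) := Submodule.pi T fun _ => ⊥
  have hxK : x ∉ Q ⊔ K := by
    intro h
    obtain ⟨y, hy, z, hz, rfl⟩ := Submodule.mem_sup.mp h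
    refine hx ⟨y, hy, fun i hi => ?_⟩
    have : z i = 0 := hz i hi
    simp [this]
  obtain ⟨f, hfx, hf⟩ := Submodule.exists_le_ker_of_notMem hxK
  have hsum (y : ι → F) : f y = ∑ i, f (Pi.single i 1) * y i := by
    rw [LinearMap.pi_apply_eq_sum_univ f y]
    refine Finset.sum_congr rfl fun i _ => ?_
    rw [smul_eq_mul, mul_comm]
    congr 2
    ext j
    simp [Pi.single_apply, eq_comm]
  refine ⟨fun i => f (Pi.single i 1), fun y hy => ?_, fun h => hfx ?_, fun i hi => ?_⟩
  · rw [← hsum]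
    exact hf (le_sup_left (a := Q) hy)
  · rw [hsum]
    exact Finset.sum_eq_zero fun i _ => by rw [congrFun h i]; simp
  · by_contra hiT
    refine hi (hf (le_sup_right (a := Q) (b := K) fun j hj => ?_))
    have hji : j ≠ i := fun h => hiT (h ▸ hj)
    exact (Submodule.mem_bot F).mpr (Pi.single_eq_of_ne hji 1)

/-- A nonzero dual vector obstructs recovering arbitrary values on its support. -/
theorem exists_not_agree_on_supp {F : Type*} [Field F] {ι : Type*} [Fintype ι]
    {Q : Set (ι → F)} {v : ι → F} (hv : v ∈ dualCode Q) (hv0 : v ≠ 0) :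
    ∃ x : ι → F, ¬ ∃ y ∈ Q, ∀ i ∈ supp v, x i = y i := by
  classical
  obtain ⟨i, hi⟩ := Function.ne_iff.mp hv0
  refine ⟨Pi.single i 1, fun ⟨y, hy, hxy⟩ => hi ?_⟩
  have hsum : ∑ j, v j * (Pi.single i 1 : ι → F) j = ∑ j, v j * y j :=
    Finset.sum_congr rfl fun j _ => by
      by_cases hj : v j = 0
      · simp [hj]
      · rw [hxy j hj]
  rw [hv y hy] at hsum
  simpa [Pi.single_apply] using hsum

theorem statement7 {F : Type*} [Field F] {n : ℕ} (Q : Submodule F (Fin n → F))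
    (𝒯 : Set (Set (Fin n))) (h𝒯 : IsCollusionPattern 𝒯) :
    lift (Q : Set (Fin n → F)) 𝒯 = Set.univ ↔
      ∀ C : Set (Fin n), IsCircuit (Q : Set (Fin n → F)) C → C ∉ 𝒯 := by
  constructor
  · rintro hlift _ ⟨⟨v, hv, hv0, rfl⟩, -⟩ hT
    obtain ⟨x, hx⟩ := exists_not_agree_on_supp hv hv0
    exact hx ((Set.eq_univ_iff_forall.mp hlift x) _ hT)
  · refine fun hcirc => Set.eq_univ_of_forall fun x T hT => ?_
    by_contra hx
    obtain ⟨v, hv, hv0, hvT⟩ := exists_mem_dualCode_supp_subset Q hx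
    obtain ⟨C, hC, hCv⟩ := exists_isCircuit_subset_supp hv hv0
    exact hcirc C hC (h𝒯 T hT C (hCv.trans hvT))
end

section
/- Let F be a field and Q₁, Q₂ ⊆ F^n two linear codes having the same set of circuits 𝒞. Suppose there exist a finite set 𝒮 ⊆ 𝒞 and, for each C ∈ 𝒮, circuit vectors v_C ∈ Q₁^⊥ and w_C ∈ Q₂^⊥ of C, such that the family (v_C)_{C∈𝒮} is F-linearly independent while the family (w_C)_{C∈𝒮} is F-linearly dependent. Let 𝒯 be the downward closure of 𝒮 (all subsets of members of 𝒮). Then the matroids of the lifts differ: there exists S ⊆ {1,…,n} such that exactly one of (Q₁^𝒯)^⊥ and (Q₂^𝒯)^⊥ contains a nonzero vector with support contained in S. -/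
/-- The subspace of vectors supported in `S`. -/
def supportedIn (F : Type*) [Field F] {ι : Type*} (S : Set ι) : Submodule F (ι → F) where
  carrier := {u | supp u ⊆ S}
  zero_mem' := fun i hi => absurd rfl hi
  add_mem' := by
    intro a b ha hb i hi
    by_contra h
    have h1 : a i = 0 := by by_contra h'; exact h (ha h')
    have h2 : b i = 0 := by by_contra h'; exact h (hb h')
    exact hi (by simp [h1, h2])
  smul_mem' := by
    intro c a ha i hi
    refine ha fun h => hi ?_
    simp [h]

/-- Double duality: a vector killed by the dual code of `W` lies in `W`. -/
theorem mem_of_forall_mem_dualCode {F : Type*} [Field F] {ι : Type*} [Fintype ι]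
    (W : Submodule F (ι → F)) (x : ι → F)
    (h : ∀ u ∈ dualCode (W : Set (ι → F)), ∑ i, u i * x i = 0) : x ∈ W := by
  classical
  by_contra hx
  obtain ⟨f, hfx, hf⟩ := Submodule.exists_le_ker_of_notMem hx
  have key : ∀ y : ι → F, ∑ i, f (Pi.single i 1) * y i = f y := by
    intro y
    rw [LinearMap.pi_apply_eq_sum_univ f y]
    refine Finset.sum_congr rfl fun i _ => ?_
    rw [smul_eq_mul, mul_comm]
    congr 2
    ext j
    simp [Pi.single_apply, eq_comm]
  refine hfx ?_
  rw [← key]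
  refine h (fun i => f (Pi.single i 1)) fun y hy => ?_
  rw [key]
  exact hf hy

theorem exists_smul_eq_of_supp_subset {F : Type*} [Field F] {ι : Type*} [Fintype ι]
    (Q : Set (ι → F)) {C : Set ι} (hC : IsCircuit Q C) {v u : ι → F}
    (hv : v ∈ dualCode Q) (hv0 : v ≠ 0) (hvC : supp v = C)
    (hu : u ∈ dualCode Q) (huC : supp u ⊆ C) : ∃ c : F, u = c • v := by
  obtain ⟨j, hj⟩ := Function.ne_iff.1 hv0
  have hj' : v j ≠ 0 := hj
  refine ⟨u j / v j, ?_⟩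
  by_contra hne
  refine hC.2 (u - (u j / v j) • v) ?_ (sub_ne_zero.2 hne) ⟨?_, ?_⟩
  · intro x hx
    have h1 := hu x hx
    have h2 := hv x hx
    simp only [Pi.sub_apply, Pi.smul_apply, smul_eq_mul, sub_mul, Finset.sum_sub_distrib,
      mul_assoc, ← Finset.mul_sum, h1, h2, mul_zero, sub_zero]
  · exact (supportedIn F C).sub_mem huC ((supportedIn F C).smul_mem _ hvC.le)
  · intro hsub
    have hjC : j ∈ C := hvC ▸ (show j ∈ supp v from hj')
    refine hsub hjC ?_
    simp [div_mul_cancel₀ _ hj']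

/-- A vector orthogonal to the circuit vector of `C` agrees on `C` with a codeword. -/
theorem exists_mem_eq_on_circuit {F : Type*} [Field F] {ι : Type*} [Fintype ι]
    (Q : Submodule F (ι → F)) {C : Set ι} (hC : IsCircuit (Q : Set (ι → F)) C) {v x : ι → F}
    (hv : v ∈ dualCode (Q : Set (ι → F))) (hv0 : v ≠ 0) (hvC : supp v = C)
    (hx : ∑ i, v i * x i = 0) : ∃ y ∈ Q, ∀ i ∈ C, x i = y i := by
  classical
  have hmem : x ∈ Q ⊔ supportedIn F Cᶜ := by
    refine mem_of_forall_mem_dualCode _ _ fun u hu => ?_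
    have huQ : u ∈ dualCode (Q : Set (ι → F)) :=
      fun y hy => hu y (Submodule.mem_sup_left hy)
    have huC : supp u ⊆ C := by
      intro i hi
      by_contra hiC
      have hs : Pi.single i (1 : F) ∈ supportedIn F Cᶜ := by
        intro k hk
        obtain rfl : k = i := by
          by_contra hki
          exact hk (Pi.single_eq_of_ne hki _)
        exact hiC
      have := hu _ (Submodule.mem_sup_right hs)
      simp [Pi.single_apply] at this
      exact hi this
    obtain ⟨c, rfl⟩ := exists_smul_eq_of_supp_subset _ hC hv hv0 hvC huQ huC
    simp only [Pi.smul_apply, smul_eq_mul, mul_assoc, ← Finset.mul_sum, hx, mul_zero]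
  obtain ⟨y, hy, z, hz, rfl⟩ := Submodule.mem_sup.1 hmem
  refine ⟨y, hy, fun i hi => ?_⟩
  have : z i = 0 := by
    by_contra h
    exact hz h hi
  simp [this]

/-- The dual of the lift over the downward closure of a set of circuits is spanned by the
circuit vectors. -/
theorem mem_dualCode_lift_iff {F : Type*} [Field F] {ι : Type*} [Fintype ι]
    (Q : Submodule F (ι → F)) (𝒮 : Finset (Set ι))
    (h𝒮 : ∀ C ∈ 𝒮, IsCircuit (Q : Set (ι → F)) C) (v : Set ι → (ι → F))
    (hv : ∀ C ∈ 𝒮, v C ∈ dualCode (Q : Set (ι → F)) ∧ v C ≠ 0 ∧ supp (v C) = C)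
    (u : ι → F) :
    u ∈ dualCode (lift (Q : Set (ι → F)) {T | ∃ C ∈ 𝒮, T ⊆ C}) ↔
      u ∈ Submodule.span F (Set.range fun C : 𝒮 => v (C : Set ι)) := by
  constructor
  · intro hu
    refine mem_of_forall_mem_dualCode _ _ fun y hy => ?_
    simp_rw [mul_comm (y _)]
    refine hu y ?_
    rintro T ⟨C, hC, hTC⟩
    obtain ⟨h1, h2, h3⟩ := hv C hC
    have hyv : ∑ i, v C i * y i = 0 := by
      simp_rw [mul_comm (v C _)]
      exact hy _ (Submodule.subset_span ⟨⟨C, hC⟩, rfl⟩)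
    obtain ⟨z, hz, hzC⟩ := exists_mem_eq_on_circuit Q (h𝒮 C hC) h1 h2 h3 hyv
    exact ⟨z, hz, fun i hi => hzC i (hTC hi)⟩
  · intro hu x hx
    induction hu using Submodule.span_induction with
    | mem u hu =>
      obtain ⟨⟨C, hC⟩, rfl⟩ := hu
      obtain ⟨h1, -, h3⟩ := hv C hC
      obtain ⟨y, hy, hxy⟩ := hx C ⟨C, hC, subset_rfl⟩
      rw [← h1 y hy]
      refine Finset.sum_congr rfl fun i _ => ?_
      by_cases hi : v C i = 0
      · simp [hi]
      · rw [hxy i (h3 ▸ (show i ∈ supp (v C) from hi))]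
    | zero => simp
    | add a b _ _ ha hb => simp [add_mul, Finset.sum_add_distrib, ha, hb]
    | smul c a _ ha => simp [mul_assoc, ← Finset.mul_sum, ha]

/-- Every subspace has a coordinate subspace as a complement. -/
theorem exists_isCompl_supportedIn {F : Type*} [Field F] {ι : Type*} [Finite ι]
    (D : Submodule F (ι → F)) : ∃ S : Set ι, IsCompl D (supportedIn F S) := by
  classical
  obtain ⟨S, hS⟩ := (Set.toFinite {S : Set ι | Disjoint D (supportedIn F S)}).exists_maximal
    ⟨∅, by
      rw [Set.mem_ofPred_eq, Submodule.disjoint_def]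
      intro x _ hx
      ext i
      by_contra h
      exact hx h⟩
  refine ⟨S, hS.1, ?_⟩
  rw [codisjoint_iff, eq_top_iff, ← (Pi.basisFun F ι).span_eq, Submodule.span_le]
  rintro _ ⟨j, rfl⟩
  rw [Pi.basisFun_apply]
  have hsingle : ∀ (T : Set ι), j ∈ T → Pi.single j (1 : F) ∈ supportedIn F T := by
    intro T hT k hk
    obtain rfl : k = j := by
      by_contra hkj
      exact hk (Pi.single_eq_of_ne hkj _)
    exact hT
  by_cases hj : j ∈ S
  · exact Submodule.mem_sup_right (hsingle S hj)
  have hnd : ¬ Disjoint D (supportedIn F (insert j S)) := fun h =>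
    hj (hS.2 h (Set.subset_insert j S) (Set.mem_insert j S))
  rw [Submodule.disjoint_def] at hnd
  push Not at hnd
  obtain ⟨u, huD, huS, hu0⟩ := hnd
  have hr : u - u j • Pi.single j (1 : F) ∈ supportedIn F S := by
    intro k hk
    by_cases hkj : k = j
    · subst hkj
      exact absurd (by simp) hk
    · have : k ∈ supp u := by
        intro h
        exact hk (by simp [h, hkj])
      exact (huS this).resolve_left hkj
  have huj : u j ≠ 0 := by
    intro h
    rw [h, zero_smul, sub_zero] at hr
    exact hu0 ((Submodule.disjoint_def.1 hS.1) u huD hr)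
  have hmem : u j • Pi.single j (1 : F) ∈ D ⊔ supportedIn F S := by
    have := (D ⊔ supportedIn F S).sub_mem (Submodule.mem_sup_left huD)
      (Submodule.mem_sup_right hr)
    simpa using this
  exact ((D ⊔ supportedIn F S).smul_mem_iff huj).1 hmem

theorem statement11 {F : Type*} [Field F] {n : ℕ} (Q₁ Q₂ : Submodule F (Fin n → F))
    (hsame : ∀ C : Set (Fin n),
      IsCircuit (Q₁ : Set (Fin n → F)) C ↔ IsCircuit (Q₂ : Set (Fin n → F)) C)
    (𝒮 : Finset (Set (Fin n)))
    (h𝒮 : ∀ C ∈ 𝒮, IsCircuit (Q₁ : Set (Fin n → F)) C)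
    (v w : Set (Fin n) → (Fin n → F))
    (hv : ∀ C ∈ 𝒮, v C ∈ dualCode (Q₁ : Set (Fin n → F)) ∧ v C ≠ 0 ∧ supp (v C) = C)
    (hw : ∀ C ∈ 𝒮, w C ∈ dualCode (Q₂ : Set (Fin n → F)) ∧ w C ≠ 0 ∧ supp (w C) = C)
    (hind : LinearIndependent F (fun C : 𝒮 => v (C : Set (Fin n))))
    (hdep : ¬ LinearIndependent F (fun C : 𝒮 => w (C : Set (Fin n)))) :
    ∃ S : Set (Fin n),
      Xor'
        (∃ u ∈ dualCode (lift (Q₁ : Set (Fin n → F)) {T | ∃ C ∈ 𝒮, T ⊆ C}),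
          u ≠ 0 ∧ supp u ⊆ S)
        (∃ u ∈ dualCode (lift (Q₂ : Set (Fin n → F)) {T | ∃ C ∈ 𝒮, T ⊆ C}),
          u ≠ 0 ∧ supp u ⊆ S) := by
  classical
  have h𝒮₂ : ∀ C ∈ 𝒮, IsCircuit (Q₂ : Set (Fin n → F)) C :=
    fun C hC => (hsame C).1 (h𝒮 C hC)
  simp only [mem_dualCode_lift_iff Q₁ 𝒮 h𝒮 v hv, mem_dualCode_lift_iff Q₂ 𝒮 h𝒮₂ w hw]
  set D₁ := Submodule.span F (Set.range fun C : 𝒮 => v (C : Set (Fin n)))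
  set D₂ := Submodule.span F (Set.range fun C : 𝒮 => w (C : Set (Fin n)))
  have hlt : Module.finrank F D₂ < Module.finrank F D₁ := by
    rw [finrank_span_eq_card hind]
    refine lt_of_le_of_ne (finrank_range_le_card _) fun h => hdep ?_
    exact linearIndependent_iff_card_eq_finrank_span.2 h.symm
  obtain ⟨S, hS⟩ := exists_isCompl_supportedIn D₂
  refine ⟨S, Or.inl ⟨?_, ?_⟩⟩
  · by_contra hno
    have hdisj : Disjoint D₁ (supportedIn F S) := by
      rw [Submodule.disjoint_def]
      intro u hu huS
      by_contra hu0
      exact hno ⟨u, hu, hu0, huS⟩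
    have h1 := Submodule.finrank_add_finrank_le_of_disjoint hdisj
    have h2 := Submodule.finrank_add_eq_of_isCompl hS
    omega
  · rintro ⟨u, hu, hu0, huS⟩
    exact hu0 (Submodule.disjoint_def.1 hS.disjoint u hu huS)
end

section
/- Let F be a field and Q ⊆ F^n a linear code whose matroid is connected. Let 𝒯 be a collusion pattern on {1,…,n} that is disconnected, i.e. there is a partition of {1,…,n} into two nonempty sets A and B such that every T ∈ 𝒯 is contained in A or contained in B. Then Q ⊊ Q^𝒯. -/
theorem statement13 {F : Type*} [Field F] {n : ℕ} (Q : Submodule F (Fin n → F))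
    (hn : 2 ≤ n)
    (hconn : ∀ i j : Fin n, i ≠ j →
      ∃ C : Set (Fin n), IsCircuit (Q : Set (Fin n → F)) C ∧ i ∈ C ∧ j ∈ C)
    (𝒯 : Set (Set (Fin n))) (h𝒯 : IsCollusionPattern 𝒯)
    (hdisc : ∃ A B : Set (Fin n), A.Nonempty ∧ B.Nonempty ∧ A ∪ B = Set.univ ∧
        Disjoint A B ∧ ∀ T ∈ 𝒯, T ⊆ A ∨ T ⊆ B) :
    (Q : Set (Fin n → F)) ⊂ lift (Q : Set (Fin n → F)) 𝒯 := by
  refine ⟨fun x hx T _ => ⟨x, hx, fun i _ => rfl⟩, fun hle => ?_⟩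
  obtain ⟨A, B, ⟨a, ha⟩, ⟨b, hb⟩, -, hAB, hT⟩ := hdisc
  rw [Set.disjoint_left] at hAB
  have hbA : b ∉ A := fun h => hAB h hb
  have hab : a ≠ b := fun h => hbA (h ▸ ha)
  have hproj : ∀ x ∈ Q, A.indicator x ∈ Q := by
    refine fun x hx => hle fun T hTmem => ?_
    rcases hT T hTmem with h | h
    · exact ⟨x, hx, fun i hi => Set.indicator_of_mem (h hi) x⟩
    · exact ⟨0, Q.zero_mem, fun i hi => Set.indicator_of_notMem (fun hA => hAB hA (h hi)) x⟩
  obtain ⟨C, ⟨⟨v, hv, -, rfl⟩, hmin⟩, haC, hbC⟩ := hconn a b hab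
  refine hmin (A.indicator v) (fun x hx => ?_) (fun h => haC ?_) ⟨fun i hi => ?_, fun h => ?_⟩
  · rw [← hv _ (hproj x hx)]
    refine Finset.sum_congr rfl fun i _ => ?_
    by_cases hi : i ∈ A <;> simp [hi]
  · simpa [ha] using congrFun h a
  · exact fun h => hi (by simp [Set.indicator, h])
  · exact h hbC (Set.indicator_of_notMem hbA v)
end

section
/- Let F be a field and Q ⊆ F^n a linear code. Let B ⊆ {1,…,n} be an information set of Q, i.e. the coordinate projection from Q onto F^B is a linear isomorphism. For each e ∉ B there is a nonzero vector v_e ∈ Q^⊥ with supp(v_e) ⊆ B ∪ {e} and e ∈ supp(v_e), and C(e,B) := supp(v_e) is the fundamental circuit of e with respect to B. If 𝒯 is a collusion pattern on {1,…,n} such that C(e,B) ∈ 𝒯 for every e ∉ B, then Q^𝒯 = Q. -/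
/-- A dual vector is orthogonal to every word that agrees with a codeword on its support. -/
theorem dualCode_sum_eq_zero {F : Type*} [Field F] {ι : Type*} [Fintype ι]
    {Q : Set (ι → F)} {v x y : ι → F} (hv : v ∈ dualCode Q) (hy : y ∈ Q)
    (h : ∀ i ∈ supp v, x i = y i) : ∑ i, v i * x i = 0 := by
  rw [← hv y hy]
  refine Finset.sum_congr rfl fun i _ => ?_
  by_cases hi : v i = 0
  · simp [hi]
  · rw [h i hi]

/-- A word agrees with a codeword `y` at `e` if it agrees with `y` on the rest of the support
of a dual vector that is orthogonal to the word and nonzero at `e`. -/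
theorem eq_of_dualCode_of_sum_eq_zero {F : Type*} [Field F] {ι : Type*} [Fintype ι]
    {Q : Set (ι → F)} {v x y : ι → F} {e : ι} (hv : v ∈ dualCode Q) (hy : y ∈ Q)
    (hx : ∑ i, v i * x i = 0) (he : e ∈ supp v)
    (h : ∀ i ∈ supp v, i ≠ e → x i = y i) : x e = y e := by
  have hsum : ∑ i, v i * (x i - y i) = 0 := by
    simp only [mul_sub, Finset.sum_sub_distrib, hx, hv y hy, sub_zero]
  have hsingle : ∑ i, v i * (x i - y i) = v e * (x e - y e) := by
    refine Fintype.sum_eq_single e fun i hie => ?_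
    by_cases hi : v i = 0
    · simp [hi]
    · rw [h i hi hie, sub_self, mul_zero]
  rw [hsingle] at hsum
  exact sub_eq_zero.mp ((mul_eq_zero.mp hsum).resolve_left he)

theorem statement15 {F : Type*} [Field F] {n : ℕ} (Q : Submodule F (Fin n → F))
    (B : Set (Fin n))
    (hB : Function.Bijective (fun y : Q => fun i : B => (y : Fin n → F) i))
    (v : Fin n → (Fin n → F))
    (hv : ∀ e ∉ B, v e ∈ dualCode (Q : Set (Fin n → F)) ∧ v e ≠ 0 ∧
      supp (v e) ⊆ B ∪ {e} ∧ e ∈ supp (v e))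
    (𝒯 : Set (Set (Fin n))) (h𝒯 : IsCollusionPattern 𝒯)
    (hfund : ∀ e ∉ B, supp (v e) ∈ 𝒯) :
    lift (Q : Set (Fin n → F)) 𝒯 = (Q : Set (Fin n → F)) := by
  refine Set.Subset.antisymm (fun x hx => ?_) fun x hx T _ => ⟨x, hx, fun _ _ => rfl⟩
  obtain ⟨⟨y, hy⟩, hyx⟩ := hB.surjective fun i : B => x i
  have hxB : ∀ i ∈ B, x i = y i := fun i hi => (congrFun hyx ⟨i, hi⟩).symm
  suffices hxy : x = y from hxy ▸ hy
  funext e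
  by_cases he : e ∈ B
  · exact hxB e he
  obtain ⟨hdual, -, hsub, hmem⟩ := hv e he
  obtain ⟨z, hz, hxz⟩ := hx _ (hfund e he)
  exact eq_of_dualCode_of_sum_eq_zero hdual hy (dualCode_sum_eq_zero hdual hz hxz) hmem
    fun i hi hie => hxB i ((hsub hi).resolve_right hie)
end

section
/- Let F be a field, n ≥ t ≥ 1, and let Q ⊆ F^n be an [n, t−1] MDS code. Let S ⊆ {1,…,n} with |S| = t−1, and let 𝒯 be the collusion pattern generated by the sets {e} ∪ S for e ∈ {1,…,n} − S, i.e. 𝒯 = {T : T ⊆ {e} ∪ S for some e ∉ S}. Then Q^𝒯 = Q. -/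
/-- Two codewords that agree on a set `S` coincide, if every nonzero codeword has weight
exceeding the size of the complement of `S`. -/
theorem eq_of_eqOn_of_ncard_compl_lt {F ι : Type*} [Field F] [Finite ι]
    {Q : Submodule F (ι → F)} {S : Set ι}
    (hQ : ∀ y ∈ Q, y ≠ 0 → Sᶜ.ncard < (supp y).ncard)
    {y z : ι → F} (hy : y ∈ Q) (hz : z ∈ Q) (h : Set.EqOn y z S) : y = z := by
  by_contra hne
  have hsub : supp (y - z) ⊆ Sᶜ := fun i hi hiS => hi (sub_eq_zero.2 (h hiS))
  exact (hQ _ (Q.sub_mem hy hz) (sub_ne_zero.2 hne)).not_ge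
    (Set.ncard_le_ncard hsub (Set.toFinite _))

/-- If codewords are determined by their values on `S ≠ univ`, then lifting over the sets
`insert e S` with `e ∉ S` adds no new vectors. -/
theorem lift_insert_eq_self {F ι : Type*} {Q : Set (ι → F)} {S : Set ι} (hS : Sᶜ.Nonempty)
    (hQ : ∀ y ∈ Q, ∀ z ∈ Q, Set.EqOn y z S → y = z) :
    lift Q {T | ∃ e ∉ S, T ⊆ insert e S} = Q := by
  refine Set.Subset.antisymm (fun x hx => ?_) fun x hx T _ => ⟨x, hx, fun _ _ => rfl⟩
  obtain ⟨e, he⟩ := hS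
  obtain ⟨y, hyQ, hy⟩ := hx _ ⟨e, he, subset_rfl⟩
  suffices x = y from this ▸ hyQ
  funext i
  by_cases hi : i ∈ S
  · exact hy i (Or.inr hi)
  · obtain ⟨z, hzQ, hz⟩ := hx _ ⟨i, hi, subset_rfl⟩
    have hyz : y = z :=
      hQ y hyQ z hzQ fun j hj => (hy j (Or.inr hj)).symm.trans (hz j (Or.inr hj))
    exact hyz ▸ hz i (Or.inl rfl)

theorem statement16 {F : Type*} [Field F] {n t : ℕ} (ht : 1 ≤ t) (htn : t ≤ n)
    (Q : Submodule F (Fin n → F))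
    (hdim : Module.finrank F Q = t - 1)
    (hMDS : ∀ y ∈ Q, y ≠ 0 → n - (t - 1) + 1 ≤ Set.ncard (supp y))
    (S : Set (Fin n)) (hS : S.ncard = t - 1) :
    lift (Q : Set (Fin n → F)) {T | ∃ e ∉ S, T ⊆ insert e S} =
      (Q : Set (Fin n → F)) := by
  have hcompl : Sᶜ.ncard = n - (t - 1) := by
    rw [Set.ncard_compl, hS, Nat.card_fin]
  refine lift_insert_eq_self (Set.nonempty_of_ncard_ne_zero (by omega)) fun y hy z hz h =>
    eq_of_eqOn_of_ncard_compl_lt (fun w hw hw0 => ?_) hy hz h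
  have := hMDS w hw hw0
  omega
end

section
/- Let 𝒮 = {C₁, …, C_m} be a finite family of finite sets. Then the following are equivalent: (1) 𝒮 admits a triangular ordering, i.e. there exist an ordering C₁, …, C_m of the family and elements e₁, …, e_m with e_i ∈ C_i for every i and {e₁, …, e_{i−1}} ∩ C_i = ∅ for every i > 1; (2) 𝒮 is hanging, i.e. for every D ∈ 𝒮 and every subfamily {C'₁, …, C'_k} ⊆ 𝒮 − {D} with D ⊆ C'₁ ∪ ⋯ ∪ C'_k, there exists an element e ∈ C'₁ ∪ ⋯ ∪ C'_k with e ∉ D that is contained in exactly one of the sets C'₁, …, C'_k. -/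
/-- A nonempty hanging family has an element contained in exactly one of its members. -/
theorem exists_mem_unique_of_hanging {α : Type*} [DecidableEq α] {𝒮 : Finset (Finset α)}
    (hne : 𝒮.Nonempty)
    (h : ∀ D ∈ 𝒮, ∀ 𝒮' ⊆ 𝒮.erase D, D ⊆ 𝒮'.biUnion id →
      ∃ x ∈ 𝒮'.biUnion id, x ∉ D ∧ (𝒮'.filter (fun c => x ∈ c)).card = 1) :
    ∃ c ∈ 𝒮, ∃ x ∈ c, ∀ c' ∈ 𝒮.erase c, x ∉ c' := by
  obtain ⟨D, hD⟩ := hne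
  by_cases hcov : D ⊆ (𝒮.erase D).biUnion id
  · obtain ⟨x, -, hxD, hcard⟩ := h D hD _ subset_rfl hcov
    obtain ⟨c, hc⟩ := Finset.card_eq_one.mp hcard
    have hiff : ∀ c', (c' ∈ 𝒮.erase D ∧ x ∈ c') ↔ c' = c := fun c' => by
      simpa only [Finset.mem_filter, Finset.mem_singleton] using Finset.ext_iff.mp hc c'
    obtain ⟨hcD, hxc⟩ := (hiff c).mpr rfl
    refine ⟨c, Finset.mem_of_mem_erase hcD, x, hxc, fun c' hc' hx => ?_⟩
    rw [Finset.mem_erase] at hc'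
    refine hc'.1 ((hiff c').mp ⟨Finset.mem_erase.mpr ⟨?_, hc'.2⟩, hx⟩)
    rintro rfl
    exact hxD hx
  · obtain ⟨x, hxD, hx⟩ := Finset.not_subset.mp hcov
    refine ⟨D, hD, x, hxD, fun c' hc' hxc' => hx ?_⟩
    exact Finset.mem_biUnion.mpr ⟨c', hc', hxc'⟩

/-- A hanging family admits a triangular ordering. -/
theorem exists_triangular_of_hanging {α : Type*} [DecidableEq α] (n : ℕ)
    (𝒮 : Finset (Finset α)) (hn : 𝒮.card = n)
    (h : ∀ D ∈ 𝒮, ∀ 𝒮' ⊆ 𝒮.erase D, D ⊆ 𝒮'.biUnion id →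
      ∃ x ∈ 𝒮'.biUnion id, x ∉ D ∧ (𝒮'.filter (fun c => x ∈ c)).card = 1) :
    ∃ C : Fin n → Finset α, Function.Injective C ∧ (∀ i, C i ∈ 𝒮) ∧
      ∃ e : Fin n → α, (∀ i, e i ∈ C i) ∧ ∀ i j, j < i → e j ∉ C i := by
  induction n generalizing 𝒮 with
  | zero =>
    exact ⟨Fin.elim0, fun i => i.elim0, fun i => i.elim0, Fin.elim0,
      fun i => i.elim0, fun i => i.elim0⟩
  | succ n ih =>
    obtain ⟨c, hc, x, hxc, hx⟩ :=
      exists_mem_unique_of_hanging (Finset.card_pos.mp (by omega)) h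
    obtain ⟨C, hinj, hC, e, he, htri⟩ := ih (𝒮.erase c)
      (by rw [Finset.card_erase_of_mem hc, hn, Nat.add_sub_cancel])
      (fun D hD 𝒮' h𝒮' => h D (Finset.mem_of_mem_erase hD) 𝒮'
        (h𝒮'.trans (Finset.erase_subset_erase D (Finset.erase_subset c 𝒮))))
    refine ⟨Fin.cons c C, Fin.cons_injective_iff.mpr ⟨?_, hinj⟩, ?_, Fin.cons x e, ?_, ?_⟩
    · rintro ⟨i, rfl⟩
      exact Finset.notMem_erase _ _ (hC i)
    · exact Fin.cases hc fun i => Finset.mem_of_mem_erase (hC i)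
    · exact Fin.cases hxc he
    · intro i j hji
      induction i using Fin.cases with
      | zero => exact absurd hji (Fin.not_lt_zero j)
      | succ i =>
        induction j using Fin.cases with
        | zero => exact hx _ (hC i)
        | succ j => exact htri i j (Fin.succ_lt_succ_iff.mp hji)

theorem statement18 {α : Type*} [DecidableEq α] (𝒮 : Finset (Finset α)) :
    (∃ C : Fin 𝒮.card → Finset α, Function.Injective C ∧ (∀ i, C i ∈ 𝒮) ∧
        ∃ e : Fin 𝒮.card → α, (∀ i, e i ∈ C i) ∧ ∀ i j, j < i → e j ∉ C i) ↔
    (∀ D ∈ 𝒮, ∀ 𝒮' ⊆ 𝒮.erase D, D ⊆ 𝒮'.biUnion id →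
        ∃ x ∈ 𝒮'.biUnion id, x ∉ D ∧ (𝒮'.filter (fun c => x ∈ c)).card = 1) := by
  refine ⟨?_, exists_triangular_of_hanging _ 𝒮 rfl⟩
  rintro ⟨C, hinj, hC, e, he, htri⟩ D hD 𝒮' h𝒮' hcov
  have hsurj : ∀ c ∈ 𝒮, ∃ i, C i = c := fun c hc => by
    have himg : Finset.univ.image C = 𝒮 :=
      Finset.eq_of_subset_of_card_le (by simpa [Finset.subset_iff] using hC)
        (by simp [Finset.card_image_of_injective _ hinj])
    rw [← himg] at hc
    simpa using hc
  obtain ⟨i, rfl⟩ := hsurj D hD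
  have hmem : ∀ c ∈ 𝒮', ∃ k, C k = c ∧ k ≠ i := fun c hc => by
    obtain ⟨hne, hc⟩ := Finset.mem_erase.mp (h𝒮' hc)
    obtain ⟨k, rfl⟩ := hsurj c hc
    exact ⟨k, rfl, fun hk => hne (hk ▸ rfl)⟩
  obtain ⟨c₀, hc₀, hic₀⟩ := Finset.mem_biUnion.mp (hcov (he i))
  obtain ⟨k₀, rfl, hk₀⟩ := hmem c₀ hc₀
  have hk₀i : k₀ < i := lt_of_le_of_ne (not_lt.mp fun hlt => htri k₀ i hlt hic₀) hk₀
  obtain ⟨j, hj, hmin⟩ := (Finset.univ.filter fun k => C k ∈ 𝒮').exists_min_image id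
    ⟨k₀, by simpa using hc₀⟩
  simp only [Finset.mem_filter, Finset.mem_univ, true_and, id] at hj hmin
  refine ⟨e j, Finset.mem_biUnion.mpr ⟨C j, hj, he j⟩,
    htri i j ((hmin k₀ hc₀).trans_lt hk₀i), Finset.card_eq_one.mpr ⟨C j, ?_⟩⟩
  ext c
  rw [Finset.mem_filter, Finset.mem_singleton]
  constructor
  · rintro ⟨hc, hjc⟩
    obtain ⟨k, rfl, -⟩ := hmem c hc
    rw [le_antisymm (not_lt.mp fun hlt => htri k j hlt hjc) (hmin k hc)]
  · rintro rfl
    exact ⟨hj, he j⟩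
end
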